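/- Let g : ℝ^{n×r} → ℝ be differentiable with L-Lipschitz gradient (‖∇g(A) − ∇g(B)‖_F ≤ L‖A − B‖_F for all A, B). Fix Y, U ∈ ℝ^{n×r} and ρ > 0, and define L(X) = g(X) + ⟨U, X − Y⟩ + (ρ/2)‖X − Y‖_F². If X⁺ ∈ ℝ^{n×r} satisfies the first-order condition ∇g(X⁺) + U + ρ(X⁺ − Y) = 0, then for every X ∈ ℝ^{n×r}, L(X⁺) − L(X) ≤ −((ρ − 3L)/2)·‖X⁺ − X‖_F². -/

import Mathlib

open Matrix BigOperators

attribute [local instance] Matrix.frobeniusNormedAddCommGroup Matrix.frobeniusNormedSpace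

/-- Frobenius inner product `⟨A, B⟩ = Tr(AᵀB) = ∑ᵢⱼ Aᵢⱼ Bᵢⱼ`. -/
def finner {n r : ℕ} (A B : Matrix (Fin n) (Fin r) ℝ) : ℝ := ∑ i, ∑ j, A i j * B i j

/-- Frobenius norm of a real matrix. -/
noncomputable def fnorm {n r : ℕ} (A : Matrix (Fin n) (Fin r) ℝ) : ℝ :=
  Real.sqrt (∑ i, ∑ j, (A i j) ^ 2)

/-- The pairing `H ↦ ⟨G, H⟩` with a fixed matrix `G`, as a continuous linear map
(with respect to the Frobenius norm). -/
noncomputable def pairCLM {n r : ℕ} (G : Matrix (Fin n) (Fin r) ℝ) :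
    Matrix (Fin n) (Fin r) ℝ →L[ℝ] ℝ :=
  LinearMap.toContinuousLinearMap
    { toFun := fun H => finner G H
      map_add' := by
        intro H₁ H₂
        simp [finner, mul_add, Finset.sum_add_distrib]
      map_smul' := by
        intro c H
        simp [finner, Finset.mul_sum, mul_left_comm] }

lemma finner_le_fnorm_mul_fnorm {n r : ℕ} (A B : Matrix (Fin n) (Fin r) ℝ) :
    finner A B ≤ fnorm A * fnorm B := by
  have h := Real.sum_mul_le_sqrt_mul_sqrt (Finset.univ : Finset (Fin n × Fin r))
    (fun p => A p.1 p.2) (fun p => B p.1 p.2)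
  simpa only [Fintype.sum_prod_type, finner, fnorm] using h

lemma fnorm_nonneg {n r : ℕ} (A : Matrix (Fin n) (Fin r) ℝ) : 0 ≤ fnorm A :=
  Real.sqrt_nonneg _

lemma fnorm_sq {n r : ℕ} (A : Matrix (Fin n) (Fin r) ℝ) : fnorm A ^ 2 = finner A A := by
  rw [fnorm, Real.sq_sqrt (by positivity)]
  simp only [finner, sq]

lemma fnorm_smul {n r : ℕ} (c : ℝ) (A : Matrix (Fin n) (Fin r) ℝ) :
    fnorm (c • A) = |c| * fnorm A := by
  rw [fnorm, fnorm, ← Real.sqrt_sq_eq_abs, ← Real.sqrt_mul (sq_nonneg c)]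
  simp only [Matrix.smul_apply, smul_eq_mul, mul_pow, Finset.mul_sum]

lemma finner_comm {n r : ℕ} (A B : Matrix (Fin n) (Fin r) ℝ) : finner A B = finner B A := by
  simp only [finner, mul_comm]

lemma finner_add_left {n r : ℕ} (A B C : Matrix (Fin n) (Fin r) ℝ) :
    finner (A + B) C = finner A C + finner B C := by
  simp only [finner, Matrix.add_apply, add_mul, Finset.sum_add_distrib]

lemma finner_sub_left {n r : ℕ} (A B C : Matrix (Fin n) (Fin r) ℝ) :
    finner (A - B) C = finner A C - finner B C := by
  simp only [finner, Matrix.sub_apply, sub_mul, Finset.sum_sub_distrib]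

lemma finner_sub_right {n r : ℕ} (A B C : Matrix (Fin n) (Fin r) ℝ) :
    finner A (B - C) = finner A B - finner A C := by
  simp only [finner, Matrix.sub_apply, mul_sub, Finset.sum_sub_distrib]

lemma finner_smul_left {n r : ℕ} (c : ℝ) (A B : Matrix (Fin n) (Fin r) ℝ) :
    finner (c • A) B = c * finner A B := by
  simp only [finner, Matrix.smul_apply, smul_eq_mul, Finset.mul_sum, mul_assoc]

lemma hasDerivAt_comp_line {E : Type*} [NormedAddCommGroup E] [NormedSpace ℝ E] {g : E → ℝ}
    {g' : E →L[ℝ] ℝ} (A D : E) (t : ℝ) (hg : HasFDerivAt g g' (A + t • D)) :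
    HasDerivAt (fun s : ℝ => g (A + s • D)) (g' D) t := by
  have hline : HasDerivAt (fun s : ℝ => A + s • D) D t := by
    simpa using ((hasDerivAt_id t).smul_const D).const_add A
  exact hg.comp_hasDerivAt t hline

/-- Quadratic lower bound for a function with `L`-Lipschitz gradient. -/
lemma add_finner_sub_le_of_lipschitz_gradient {n r : ℕ} {L : ℝ}
    {g : Matrix (Fin n) (Fin r) ℝ → ℝ}
    {gradg : Matrix (Fin n) (Fin r) ℝ → Matrix (Fin n) (Fin r) ℝ}
    (hdiff : ∀ A, HasFDerivAt g (pairCLM (gradg A)) A)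
    (hLip : ∀ A B, fnorm (gradg A - gradg B) ≤ L * fnorm (A - B))
    (A D : Matrix (Fin n) (Fin r) ℝ) :
    g A + finner (gradg A) D - L / 2 * fnorm D ^ 2 ≤ g (A + D) := by
  let φ : ℝ → ℝ := fun t =>
    g (A + t • D) - t * finner (gradg A) D + L / 2 * fnorm D ^ 2 * t ^ 2
  have hφ (t : ℝ) : HasDerivAt φ
      (finner (gradg (A + t • D)) D - finner (gradg A) D + L * fnorm D ^ 2 * t) t := by
    have hg : HasDerivAt (fun t : ℝ => g (A + t • D)) (finner (gradg (A + t • D)) D) t :=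
      hasDerivAt_comp_line A D t (hdiff (A + t • D))
    refine ((hg.sub ((hasDerivAt_id t).mul_const (finner (gradg A) D))).add
      ((hasDerivAt_pow 2 t).const_mul (L / 2 * fnorm D ^ 2))).congr_deriv ?_
    push_cast
    ring
  have hmono : MonotoneOn φ (Set.Icc 0 1) := by
    refine monotoneOn_of_deriv_nonneg (convex_Icc 0 1)
      (fun t _ => (hφ t).continuousAt.continuousWithinAt)
      (fun t _ => (hφ t).differentiableAt.differentiableWithinAt) fun t ht => ?_
    have ht0 : 0 ≤ t := (interior_subset ht).1
    rw [(hφ t).deriv]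
    have hcs := finner_le_fnorm_mul_fnorm (gradg A - gradg (A + t • D)) D
    have hl : fnorm (gradg A - gradg (A + t • D)) ≤ L * (t * fnorm D) := by
      have h := hLip A (A + t • D)
      rwa [show A - (A + t • D) = (-t) • D by simp, fnorm_smul, abs_neg,
        abs_of_nonneg ht0] at h
    rw [finner_sub_left] at hcs
    nlinarith [mul_le_mul_of_nonneg_right hl (fnorm_nonneg D)]
  have h := hmono (Set.left_mem_Icc.2 zero_le_one) (Set.right_mem_Icc.2 zero_le_one) zero_le_one
  simp only [φ, zero_smul, one_smul, add_zero] at h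
  linarith

/-- Descent of the augmented Lagrangian at the exact minimizer of the
`X`-update, when `g` is differentiable with `L`-Lipschitz gradient. -/
theorem augLag_X_update_descent_lipschitz {n r : ℕ} (L : ℝ)
    (g : Matrix (Fin n) (Fin r) ℝ → ℝ)
    (gradg : Matrix (Fin n) (Fin r) ℝ → Matrix (Fin n) (Fin r) ℝ)
    (hdiff : ∀ A, HasFDerivAt g (pairCLM (gradg A)) A)
    (hLip : ∀ A B, fnorm (gradg A - gradg B) ≤ L * fnorm (A - B))
    (Y U : Matrix (Fin n) (Fin r) ℝ) (ρ : ℝ) (hρ : 0 < ρ)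
    (𝓛 : Matrix (Fin n) (Fin r) ℝ → ℝ)
    (h𝓛 : ∀ X, 𝓛 X = g X + finner U (X - Y) + ρ / 2 * fnorm (X - Y) ^ 2)
    (Xp : Matrix (Fin n) (Fin r) ℝ)
    (hopt : gradg Xp + U + ρ • (Xp - Y) = 0) :
    ∀ X, 𝓛 Xp - 𝓛 X ≤ -((ρ - 3 * L) / 2) * fnorm (Xp - X) ^ 2 := by
  intro X
  have hlow := add_finner_sub_le_of_lipschitz_gradient hdiff hLip Xp (X - Xp)
  rw [add_sub_cancel] at hlow
  have hstat : finner (gradg Xp) (X - Xp) + finner U (X - Xp)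
      + ρ * finner (Xp - Y) (X - Xp) = 0 := by
    rw [← finner_smul_left, ← finner_add_left, ← finner_add_left, hopt]
    simp [finner]
  have hL : 0 ≤ L * fnorm (Xp - X) := (fnorm_nonneg _).trans (hLip Xp X)
  have hL2 := mul_nonneg hL (fnorm_nonneg (Xp - X))
  rw [mul_assoc, ← sq] at hL2
  rw [h𝓛, h𝓛]
  simp only [fnorm_sq, finner_sub_left, finner_sub_right] at hlow hstat hL2 ⊢
  rw [finner_comm X Xp, finner_comm Y Xp, finner_comm Y X] at *
  linarith
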